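/- arXiv:1709.06652 — 4 statements merged into one kernel-verified Lean document; each statement's English description precedes it below -/
import Mathlib

section
/- Let N, n be natural numbers with N ≥ 1, and let k : Fin N → Fin N → ℝ be symmetric with k i i = 0 and satisfying k_min ≤ k i j ≤ k_max for all i ≠ j, where 0 < k_min ≤ k_max. Set α_i = ∑_j k i j and α_min = min_i α_i. Then for every ε : Fin N → EuclideanSpace ℝ (Fin n), ∑_i ‖∑_j (k i j) • (ε i - ε j)‖² ≥ (α_min · k_min / k_max) · P, where P = (1/2) · ∑_i ∑_j (k i j) · ‖ε i - ε j‖². -/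
open scoped RealInnerProductSpace

section WeightedLaplacian

variable {ι E : Type*} [Fintype ι] [NormedAddCommGroup E] [InnerProductSpace ℝ E]

/-- The quadratic form of a weighted graph Laplacian is the potential energy. -/
theorem sum_inner_sum_smul_sub (k : ι → ι → ℝ) (hsymm : ∀ i j, k i j = k j i) (u : ι → E) :
    ∑ i, ⟪∑ j, k i j • (u i - u j), u i⟫ =
      (1 / 2) * ∑ i, ∑ j, k i j * ‖u i - u j‖ ^ 2 := by
  have h₁ : ∑ i, ⟪∑ j, k i j • (u i - u j), u i⟫ =
      ∑ i, ∑ j, k i j * ⟪u i - u j, u i⟫ := by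
    simp only [sum_inner, real_inner_smul_left]
  have h₂ : ∑ i, ∑ j, k i j * ⟪u i - u j, u i⟫ =
      ∑ i, ∑ j, -(k i j * ⟪u i - u j, u j⟫) := by
    rw [Finset.sum_comm]
    refine Finset.sum_congr rfl fun i _ => Finset.sum_congr rfl fun j _ => ?_
    rw [hsymm j i, ← neg_sub (u i) (u j), inner_neg_left, mul_neg]
  have h₃ : ∑ i, ∑ j, k i j * ‖u i - u j‖ ^ 2 =
      ∑ i, ∑ j, k i j * ⟪u i - u j, u i⟫ + ∑ i, ∑ j, -(k i j * ⟪u i - u j, u j⟫) := by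
    simp only [← Finset.sum_add_distrib]
    refine Finset.sum_congr rfl fun i _ => Finset.sum_congr rfl fun j _ => ?_
    rw [← real_inner_self_eq_norm_sq, inner_sub_right]
    ring
  rw [h₁, h₃, ← h₂]
  ring

/-- For vectors with zero sum, the variance is half the sum of squared pairwise distances. -/
theorem card_mul_sum_norm_sq (u : ι → E) (hu : ∑ i, u i = 0) :
    Fintype.card ι * ∑ i, ‖u i‖ ^ 2 = (1 / 2) * ∑ i, ∑ j, ‖u i - u j‖ ^ 2 := by
  have h := sum_inner_sum_smul_sub (fun _ _ => 1) (fun _ _ => rfl) u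
  simp only [one_smul, one_mul, Finset.sum_sub_distrib, hu, sub_zero, Finset.sum_const,
    Finset.card_univ, ← Nat.cast_smul_eq_nsmul ℝ, real_inner_smul_left,
    real_inner_self_eq_norm_sq, ← Finset.mul_sum] at h
  exact h

/-- A weighted graph Laplacian with weights at least `c` on a complete graph has spectral gap at
least `card ι * c`. -/
theorem card_mul_energy_le_sum_norm_sq [Nonempty ι] (k : ι → ι → ℝ)
    (hsymm : ∀ i j, k i j = k j i) {c : ℝ} (hc : 0 ≤ c) (hk : ∀ i j, i ≠ j → c ≤ k i j)
    (ε : ι → E) :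
    Fintype.card ι * c * ((1 / 2) * ∑ i, ∑ j, k i j * ‖ε i - ε j‖ ^ 2) ≤
      ∑ i, ‖∑ j, k i j • (ε i - ε j)‖ ^ 2 := by
  have hN : (Fintype.card ι : ℝ) ≠ 0 := Nat.cast_ne_zero.mpr Fintype.card_ne_zero
  set m : E := (Fintype.card ι : ℝ)⁻¹ • ∑ i, ε i with hm
  obtain ⟨u, hu⟩ : ∃ u : ι → E, u = fun i => ε i - m := ⟨_, rfl⟩
  have hdiff : ∀ i j, ε i - ε j = u i - u j := fun i j => by simp [hu]
  have hsum : ∑ i, u i = 0 := by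
    simp [hu, hm, Finset.sum_sub_distrib, ← Nat.cast_smul_eq_nsmul ℝ, smul_smul, hN]
  simp only [hdiff]
  have hcard := card_mul_sum_norm_sq u hsum
  have henergy := sum_inner_sum_smul_sub k hsymm u
  have hle : c * ∑ i, ∑ j, ‖u i - u j‖ ^ 2 ≤ ∑ i, ∑ j, k i j * ‖u i - u j‖ ^ 2 := by
    simp only [Finset.mul_sum]
    refine Finset.sum_le_sum fun i _ => Finset.sum_le_sum fun j _ => ?_
    rcases eq_or_ne i j with rfl | hij
    · simp
    · exact mul_le_mul_of_nonneg_right (hk i j hij) (sq_nonneg _)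
  set d : ℝ := Fintype.card ι * c with hd
  have hd0 : 0 ≤ d := by positivity
  have hexp : ∑ i, ‖(∑ j, k i j • (u i - u j)) - d • u i‖ ^ 2 =
      ∑ i, ‖∑ j, k i j • (u i - u j)‖ ^ 2
        - 2 * d * ∑ i, ⟪∑ j, k i j • (u i - u j), u i⟫ + d ^ 2 * ∑ i, ‖u i‖ ^ 2 := by
    simp only [Finset.mul_sum, ← Finset.sum_sub_distrib, ← Finset.sum_add_distrib]
    refine Finset.sum_congr rfl fun i _ => ?_
    rw [norm_sub_sq_real, real_inner_smul_right, norm_smul, mul_pow, Real.norm_eq_abs, sq_abs]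
    ring
  have hpos : 0 ≤ ∑ i, ‖(∑ j, k i j • (u i - u j)) - d • u i‖ ^ 2 :=
    Finset.sum_nonneg fun i _ => sq_nonneg _
  rw [hexp, henergy] at hpos
  have hgap : d * ∑ i, ‖u i‖ ^ 2 ≤ (1 / 2) * ∑ i, ∑ j, k i j * ‖u i - u j‖ ^ 2 := by
    rw [hd, mul_right_comm, hcard]
    linarith
  linarith [mul_le_mul_of_nonneg_left hgap hd0]

end WeightedLaplacian

theorem stmt3 (N n : ℕ) (hN : 1 ≤ N) (kmin kmax : ℝ)
    (hkmin : 0 < kmin) (hkk : kmin ≤ kmax)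
    (k : Fin N → Fin N → ℝ)
    (hsymm : ∀ i j, k i j = k j i)
    (hdiag : ∀ i, k i i = 0)
    (hbound : ∀ i j, i ≠ j → kmin ≤ k i j ∧ k i j ≤ kmax)
    (ε : Fin N → EuclideanSpace ℝ (Fin n)) :
    ∑ i, ‖∑ j, (k i j) • (ε i - ε j)‖ ^ 2
      ≥ ((⨅ i, ∑ j, k i j) * kmin / kmax) *
          ((1 / 2) * ∑ i, ∑ j, (k i j) * ‖ε i - ε j‖ ^ 2) := by
  have : Nonempty (Fin N) := ⟨⟨0, hN⟩⟩
  have hkmax : 0 < kmax := hkmin.trans_le hkk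
  have hk : ∀ i j, 0 ≤ k i j ∧ k i j ≤ kmax := fun i j => by
    rcases eq_or_ne i j with rfl | hij
    · simp [hdiag, hkmax.le]
    · exact ⟨hkmin.le.trans (hbound i j hij).1, (hbound i j hij).2⟩
  have hα : ⨅ i, ∑ j, k i j ≤ N * kmax :=
    (ciInf_le (Set.finite_range _).bddBelow ⟨0, hN⟩).trans <| by
      simpa using Finset.sum_le_sum fun j (_ : j ∈ Finset.univ) => (hk ⟨0, hN⟩ j).2
  have hcoef : (⨅ i, ∑ j, k i j) * kmin / kmax ≤ N * kmin := by
    rw [div_le_iff₀ hkmax, mul_right_comm]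
    exact mul_le_mul_of_nonneg_right hα hkmin.le
  have hP : 0 ≤ (1 / 2) * ∑ i, ∑ j, k i j * ‖ε i - ε j‖ ^ 2 :=
    mul_nonneg (by norm_num) <| Finset.sum_nonneg fun i _ => Finset.sum_nonneg fun j _ =>
      mul_nonneg (hk i j).1 (sq_nonneg _)
  have hgap := card_mul_energy_le_sum_norm_sq k hsymm hkmin.le (fun i j h => (hbound i j h).1) ε
  rw [Fintype.card_fin] at hgap
  exact (mul_le_mul_of_nonneg_right hcoef hP).trans hgap
end

section
/- Let N, n be natural numbers with N ≥ 1, and let k : Fin N → Fin N → ℝ be symmetric with k i i = 0 and k_min ≤ k i j ≤ k_max for all i ≠ j, where 0 < k_min ≤ k_max. Set α_i = ∑_j k i j and α_min = min_i α_i, and let k₀ ≥ 0. For ε : Fin N → EuclideanSpace ℝ (Fin n), define g i = (∑_j (k i j) • (ε i - ε j)) + k₀ • (ε i) and P = (1/2) · ∑_i ∑_j (k i j) · ‖ε i - ε j‖². Then ∑_i ‖g i‖² ≥ k₀² · ∑_i ‖ε i‖² + (2 · k₀ + α_min · k_min / k_max) · P. -/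
open scoped RealInnerProductSpace

section WeightedLaplacian

variable {ι E : Type*} [Fintype ι] [NormedAddCommGroup E] [InnerProductSpace ℝ E]

/-- The quadratic form of a weighted graph Laplacian is its Dirichlet energy. -/
theorem sum_inner_laplacian_self (k : ι → ι → ℝ) (hsymm : ∀ i j, k i j = k j i) (x : ι → E) :
    ∑ i, ⟪∑ j, k i j • (x i - x j), x i⟫ = (1 / 2) * ∑ i, ∑ j, k i j * ‖x i - x j‖ ^ 2 := by
  have h₁ : ∑ i, ⟪∑ j, k i j • (x i - x j), x i⟫ = ∑ i, ∑ j, k i j * ⟪x i - x j, x i⟫ := by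
    simp only [sum_inner, real_inner_smul_left]
  have h₂ : ∑ i, ∑ j, k i j * ⟪x i - x j, x i⟫ = ∑ i, ∑ j, -(k i j * ⟪x i - x j, x j⟫) := by
    rw [Finset.sum_comm]
    refine Finset.sum_congr rfl fun i _ => Finset.sum_congr rfl fun j _ => ?_
    rw [hsymm j i, ← neg_sub (x i) (x j), inner_neg_left, mul_neg]
  have h₃ : ∑ i, ∑ j, k i j * ‖x i - x j‖ ^ 2
      = ∑ i, ∑ j, k i j * ⟪x i - x j, x i⟫ + ∑ i, ∑ j, -(k i j * ⟪x i - x j, x j⟫) := by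
    simp only [← Finset.sum_add_distrib]
    refine Finset.sum_congr rfl fun i _ => Finset.sum_congr rfl fun j _ => ?_
    rw [← real_inner_self_eq_norm_sq, inner_sub_right]
    ring
  rw [h₁, h₃, ← h₂]
  ring

/-- For a centered family, the sum of squared norms is determined by the pairwise distances. -/
theorem card_mul_sum_norm_sq_of_sum_eq_zero (x : ι → E) (hx : ∑ i, x i = 0) :
    Fintype.card ι * ∑ i, ‖x i‖ ^ 2 = (1 / 2) * ∑ i, ∑ j, ‖x i - x j‖ ^ 2 := by
  have h := sum_inner_laplacian_self (fun _ _ : ι => (1 : ℝ)) (fun _ _ => rfl) x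
  simp only [one_smul, one_mul, Finset.sum_sub_distrib, hx, sub_zero, Finset.sum_const,
    Finset.card_univ, ← Nat.cast_smul_eq_nsmul ℝ, real_inner_smul_left,
    real_inner_self_eq_norm_sq, ← Finset.mul_sum] at h
  exact h

/-- Spectral gap of a complete weighted graph with weights at least `c`, for centered families. -/
theorem laplacian_spectral_gap_of_sum_eq_zero (k : ι → ι → ℝ) (hsymm : ∀ i j, k i j = k j i)
    {c : ℝ} (hc : 0 ≤ c) (hk : ∀ i j, i ≠ j → c ≤ k i j) (x : ι → E) (hx : ∑ i, x i = 0) :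
    Fintype.card ι * c * ((1 / 2) * ∑ i, ∑ j, k i j * ‖x i - x j‖ ^ 2)
      ≤ ∑ i, ‖∑ j, k i j • (x i - x j)‖ ^ 2 := by
  set r : ℝ := Fintype.card ι * c with hr
  have hr₀ : 0 ≤ r := by positivity
  have hP := sum_inner_laplacian_self k hsymm x
  have hlow : r * ∑ i, ‖x i‖ ^ 2 ≤ (1 / 2) * ∑ i, ∑ j, k i j * ‖x i - x j‖ ^ 2 := by
    have hle : c * ∑ i, ∑ j, ‖x i - x j‖ ^ 2 ≤ ∑ i, ∑ j, k i j * ‖x i - x j‖ ^ 2 := by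
      simp only [Finset.mul_sum]
      refine Finset.sum_le_sum fun i _ => Finset.sum_le_sum fun j _ => ?_
      rcases eq_or_ne i j with rfl | hij
      · simp
      · exact mul_le_mul_of_nonneg_right (hk i j hij) (sq_nonneg _)
    have hcard := card_mul_sum_norm_sq_of_sum_eq_zero x hx
    calc r * ∑ i, ‖x i‖ ^ 2 = c * (Fintype.card ι * ∑ i, ‖x i‖ ^ 2) := by rw [hr]; ring
      _ ≤ _ := by rw [hcard]; linarith
  have hsq (y : ι → E) : 0 ≤ ∑ i, ‖y i‖ ^ 2 - 2 * (r * ∑ i, ⟪y i, x i⟫)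
      + r ^ 2 * ∑ i, ‖x i‖ ^ 2 := by
    have h : 0 ≤ ∑ i, ‖y i - r • x i‖ ^ 2 := Finset.sum_nonneg fun _ _ => sq_nonneg _
    simpa only [norm_sub_sq_real, real_inner_smul_right, norm_smul, mul_pow, Real.norm_eq_abs,
      sq_abs, Finset.sum_add_distrib, Finset.sum_sub_distrib, ← Finset.mul_sum] using h
  have hgap := hsq fun i => ∑ j, k i j • (x i - x j)
  rw [hP] at hgap
  nlinarith [mul_le_mul_of_nonneg_left hlow hr₀]

/-- Spectral gap of a complete weighted graph with weights at least `c`. -/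
theorem laplacian_spectral_gap [Nonempty ι] (k : ι → ι → ℝ) (hsymm : ∀ i j, k i j = k j i)
    {c : ℝ} (hc : 0 ≤ c) (hk : ∀ i j, i ≠ j → c ≤ k i j) (x : ι → E) :
    Fintype.card ι * c * ((1 / 2) * ∑ i, ∑ j, k i j * ‖x i - x j‖ ^ 2)
      ≤ ∑ i, ‖∑ j, k i j • (x i - x j)‖ ^ 2 := by
  have hcard : (Fintype.card ι : ℝ) ≠ 0 := by exact_mod_cast Fintype.card_ne_zero
  have h := laplacian_spectral_gap_of_sum_eq_zero k hsymm hc hk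
    (fun i => x i - (Fintype.card ι : ℝ)⁻¹ • ∑ j, x j) (by
      rw [Finset.sum_sub_distrib, Finset.sum_const, Finset.card_univ,
        ← Nat.cast_smul_eq_nsmul ℝ, smul_inv_smul₀ hcard, sub_self])
  simpa only [sub_sub_sub_cancel_right] using h

end WeightedLaplacian

theorem stmt5 (N n : ℕ) (hN : 1 ≤ N) (kmin kmax : ℝ)
    (hkmin : 0 < kmin) (hkk : kmin ≤ kmax)
    (k : Fin N → Fin N → ℝ)
    (hsymm : ∀ i j, k i j = k j i)
    (hdiag : ∀ i, k i i = 0)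
    (hbound : ∀ i j, i ≠ j → kmin ≤ k i j ∧ k i j ≤ kmax)
    (k₀ : ℝ) (hk₀ : 0 ≤ k₀)
    (ε : Fin N → EuclideanSpace ℝ (Fin n)) :
    ∑ i, ‖(∑ j, (k i j) • (ε i - ε j)) + k₀ • (ε i)‖ ^ 2
      ≥ k₀ ^ 2 * ∑ i, ‖ε i‖ ^ 2
        + (2 * k₀ + (⨅ i, ∑ j, k i j) * kmin / kmax) *
            ((1 / 2) * ∑ i, ∑ j, (k i j) * ‖ε i - ε j‖ ^ 2) := by
  have : Nonempty (Fin N) := ⟨⟨0, hN⟩⟩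
  have hkmax : 0 < kmax := hkmin.trans_le hkk
  have hle (i j : Fin N) : k i j ≤ kmax := by
    rcases eq_or_ne i j with rfl | hij
    · exact (hdiag i).trans_le hkmax.le
    · exact (hbound i j hij).2
  have hnonneg (i j : Fin N) : 0 ≤ k i j := by
    rcases eq_or_ne i j with rfl | hij
    · exact (hdiag i).ge
    · exact hkmin.le.trans (hbound i j hij).1
  have hinf : (⨅ i, ∑ j, k i j) ≤ N * kmax := by
    refine (ciInf_le (Set.finite_range _).bddBelow ⟨0, hN⟩).trans ?_
    refine (Finset.sum_le_sum fun j _ => hle _ j).trans_eq ?_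
    simp
  have hcoef : (⨅ i, ∑ j, k i j) * kmin / kmax ≤ N * kmin := by
    rw [div_le_iff₀ hkmax]
    nlinarith [mul_le_mul_of_nonneg_right hinf hkmin.le]
  have hgap := laplacian_spectral_gap k hsymm hkmin.le (fun i j hij => (hbound i j hij).1) ε
  rw [Fintype.card_fin] at hgap
  have hP₀ : 0 ≤ (1 / 2) * ∑ i, ∑ j, k i j * ‖ε i - ε j‖ ^ 2 :=
    mul_nonneg (by norm_num) (Finset.sum_nonneg fun i _ => Finset.sum_nonneg fun j _ =>
      mul_nonneg (hnonneg i j) (sq_nonneg _))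
  simp only [norm_add_sq_real, real_inner_smul_right, norm_smul, mul_pow, Real.norm_eq_abs,
    sq_abs, Finset.sum_add_distrib, ← Finset.mul_sum, sum_inner_laplacian_self k hsymm ε]
  linarith [mul_le_mul_of_nonneg_right hcoef hP₀]
end

section
/- Let N, n be natural numbers with N ≥ 1, and let k : Fin N → Fin N → ℝ be symmetric with k i i = 0 and k_min ≤ k i j ≤ k_max for all i ≠ j, where 0 < k_min ≤ k_max. Set α_i = ∑_j k i j, α_min = min_i α_i and r = α_min · k_min / k_max. Let k₀ ≥ 0 and k₃ = min {1, k₀, 2·k₀·(2·k₀ + r)}. For ε : Fin N → EuclideanSpace ℝ (Fin n), define g i = (∑_j (k i j) • (ε i - ε j)) + k₀ • (ε i) and P = (1/2) · ∑_i ∑_j (k i j) · ‖ε i - ε j‖². Then ∑_i ‖g i‖² ≥ k₃ · (k₀ · ∑_i ‖ε i‖² + P / 2). -/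
open scoped RealInnerProductSpace

/-- The Dirichlet form of a symmetric weighted graph Laplacian as a sum over pairs. -/
theorem sum_inner_laplacian {ι E : Type*} [Fintype ι] [NormedAddCommGroup E]
    [InnerProductSpace ℝ E] (k : ι → ι → ℝ) (hsymm : ∀ i j, k i j = k j i) (ε : ι → E) :
    ∑ i, ⟪∑ j, k i j • (ε i - ε j), ε i⟫ =
      (1 / 2) * ∑ i, ∑ j, k i j * ‖ε i - ε j‖ ^ 2 := by
  have expand : ∑ i, ⟪∑ j, k i j • (ε i - ε j), ε i⟫ =
      ∑ i, ∑ j, k i j * ⟪ε i - ε j, ε i⟫ := by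
    simp only [sum_inner, real_inner_smul_left]
  have swap : ∑ i, ∑ j, k i j * ⟪ε i - ε j, ε i⟫ =
      ∑ i, ∑ j, k i j * ⟪ε j - ε i, ε j⟫ := by
    rw [Finset.sum_comm]
    simp only [hsymm]
  have pair : ∑ i, ∑ j, k i j * ‖ε i - ε j‖ ^ 2 =
      ∑ i, ∑ j, k i j * ⟪ε i - ε j, ε i⟫ + ∑ i, ∑ j, k i j * ⟪ε j - ε i, ε j⟫ := by
    simp only [← Finset.sum_add_distrib]
    refine Finset.sum_congr rfl fun i _ => Finset.sum_congr rfl fun j _ => ?_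
    rw [← real_inner_self_eq_norm_sq]
    simp only [inner_sub_left, inner_sub_right]
    ring
  linarith

theorem stmt6 (N n : ℕ) (hN : 1 ≤ N) (kmin kmax : ℝ)
    (hkmin : 0 < kmin) (hkk : kmin ≤ kmax)
    (k : Fin N → Fin N → ℝ)
    (hsymm : ∀ i j, k i j = k j i)
    (hdiag : ∀ i, k i i = 0)
    (hbound : ∀ i j, i ≠ j → kmin ≤ k i j ∧ k i j ≤ kmax)
    (k₀ : ℝ) (hk₀ : 0 ≤ k₀)
    (ε : Fin N → EuclideanSpace ℝ (Fin n)) :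
    ∑ i, ‖(∑ j, (k i j) • (ε i - ε j)) + k₀ • (ε i)‖ ^ 2
      ≥ min 1 (min k₀
            (2 * k₀ * (2 * k₀ + (⨅ i, ∑ j, k i j) * kmin / kmax))) *
          (k₀ * ∑ i, ‖ε i‖ ^ 2
            + ((1 / 2) * ∑ i, ∑ j, (k i j) * ‖ε i - ε j‖ ^ 2) / 2) := by
  set S := ∑ i, ‖ε i‖ ^ 2 with hS
  set P := (1 / 2) * ∑ i, ∑ j, k i j * ‖ε i - ε j‖ ^ 2 with hP
  have hS_nonneg : 0 ≤ S := Finset.sum_nonneg fun i _ => sq_nonneg _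
  have hk_nonneg : ∀ i j, 0 ≤ k i j := fun i j => by
    rcases eq_or_ne i j with rfl | h
    · exact (hdiag i).ge
    · exact hkmin.le.trans (hbound i j h).1
  have hP_nonneg : 0 ≤ P := mul_nonneg (by norm_num) <| Finset.sum_nonneg fun i _ =>
    Finset.sum_nonneg fun j _ => mul_nonneg (hk_nonneg i j) (sq_nonneg _)
  have lower : 2 * k₀ * P + k₀ ^ 2 * S ≤
      ∑ i, ‖(∑ j, k i j • (ε i - ε j)) + k₀ • ε i‖ ^ 2 := by
    rw [hP, ← sum_inner_laplacian k hsymm ε, hS, Finset.mul_sum, Finset.mul_sum,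
      ← Finset.sum_add_distrib]
    refine Finset.sum_le_sum fun i _ => ?_
    rw [norm_add_sq_real, real_inner_smul_right, norm_smul, mul_pow, Real.norm_eq_abs, sq_abs]
    linarith [sq_nonneg ‖∑ j, k i j • (ε i - ε j)‖]
  refine ge_iff_le.mpr <| (mul_le_mul_of_nonneg_right
    ((min_le_right _ _).trans (min_le_left _ _)) (by positivity)).trans (le_trans ?_ lower)
  linarith [mul_nonneg hk₀ hP_nonneg]
end

section
/- Let E be a real inner product space, let k_s, k_p, k_g, η be positive real numbers, and let b be a real number with 0 < b < k_s / (k_s · k_p + k_g). Then for all v, g ∈ E, k_s · ‖v + k_p • g‖² + k_p · k_g · ‖g‖² + η > k_g · b · ‖v‖². -/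
open scoped RealInnerProductSpace

theorem stmt11 (E : Type*) [NormedAddCommGroup E] [InnerProductSpace ℝ E]
    (ks kp kg η b : ℝ) (hks : 0 < ks) (hkp : 0 < kp) (hkg : 0 < kg) (hη : 0 < η)
    (hb : 0 < b) (hb' : b < ks / (ks * kp + kg)) (v g : E) :
    ks * ‖v + kp • g‖ ^ 2 + kp * kg * ‖g‖ ^ 2 + η > kg * b * ‖v‖ ^ 2 := by
  have hD : 0 < ks * kp + kg := by positivity
  have hbD : b * (ks * kp + kg) < ks := (lt_div_iff₀ hD).mp hb'
  have hv : ‖v‖ ≤ ‖v + kp • g‖ + kp * ‖g‖ := by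
    have h := norm_sub_le (v + kp • g) (kp • g)
    rwa [add_sub_cancel_right, norm_smul, Real.norm_of_nonneg hkp.le] at h
  have hv_sq : ‖v‖ ^ 2 ≤ (‖v + kp • g‖ + kp * ‖g‖) ^ 2 := by gcongr
  have hquad : kg * b * ‖v‖ ^ 2 ≤ ks * ‖v + kp • g‖ ^ 2 + kp * kg * ‖g‖ ^ 2 := by
    refine le_of_mul_le_mul_right ?_ hD
    calc kg * b * ‖v‖ ^ 2 * (ks * kp + kg)
        = kg * ‖v‖ ^ 2 * (b * (ks * kp + kg)) := by ring
      _ ≤ kg * (‖v + kp • g‖ + kp * ‖g‖) ^ 2 * ks := by gcongr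
      _ ≤ (ks * ‖v + kp • g‖ ^ 2 + kp * kg * ‖g‖ ^ 2) * (ks * kp + kg) := by
        linarith [mul_nonneg hkp.le (sq_nonneg (ks * ‖v + kp • g‖ - kg * ‖g‖))]
  linarith
end
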